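/- Let Δ be an additive subgroup of ℂ, b ∈ ℂ with b ≠ 0, φ : Δ → ℂ an additive group homomorphism, and c ∈ ℂ. Then the free ℂ[∂]-module CL_3(b,φ,c) = ⊕_{α ∈ Δ, i ∈ ℕ} ℂ[∂]x_{α,i} with λ-bracket [x_{α,i} λ x_{β,j}] = ∂((α+b)x_{α+β,i+j} + i x_{α+β,i+j−1}) + λ((α+β+2b)x_{α+β,i+j} + (i+j)x_{α+β,i+j−1}) + (1/b)((β+b)φ(α) − (α+b)φ(β)) x_{α+β,i+j} + (1/b)(j(φ(α) − c(α+b)) + i(c(β+b) − φ(β))) x_{α+β,i+j−1}, with terms of second index −1 read as 0 and the bracket extended by conformal sesquilinearity, is a simple Lie conformal algebra. -/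

import Mathlib

set_option maxSynthPendingDepth 3

namespace QLCA

variable {V : Type} [AddCommGroup V] [Module ℂ V]

/-- Bilinearity over `ℂ` of a binary product. -/
def IsBilin (f : V → V → V) : Prop :=
  (∀ x y z : V, f (x + y) z = f x z + f y z) ∧
  (∀ x y z : V, f x (y + z) = f x y + f x z) ∧
  (∀ (c : ℂ) (x y : V), f (c • x) y = c • f x y) ∧
  (∀ (c : ℂ) (x y : V), f x (c • y) = c • f x y)

/-- `(V, f)` is a Novikov algebra over `ℂ`. -/
def IsNovikov (f : V → V → V) : Prop :=
  IsBilin f ∧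
  (∀ a b c : V, f (f a b) c - f a (f b c) = f (f b a) c - f b (f a c)) ∧
  (∀ a b c : V, f (f a b) c = f (f a c) b)

/-- `I` is an ideal of the Novikov algebra `(V, f)`. -/
def IsNovikovIdeal (f : V → V → V) (I : Submodule ℂ V) : Prop :=
  ∀ a ∈ I, ∀ b : V, f a b ∈ I ∧ f b a ∈ I

/-- The Novikov algebra `(V, f)` is simple. -/
def NovikovSimple (f : V → V → V) : Prop :=
  (∃ a b : V, f a b ≠ 0) ∧
  ∀ I : Submodule ℂ V, IsNovikovIdeal f I → I = ⊥ ∨ I = ⊤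

/-- `(V, f)` is a Lie algebra over `ℂ`. -/
def IsLieBracket (f : V → V → V) : Prop :=
  IsBilin f ∧
  (∀ a b : V, f a b = - f b a) ∧
  (∀ a b c : V, f a (f b c) = f (f a b) c + f b (f a c))

/-- The Gel'fand-Dorfman compatibility condition between a Novikov product and
a Lie bracket. -/
def GDcompat (mul lie : V → V → V) : Prop :=
  ∀ a b c : V,
    lie (mul a b) c - lie (mul a c) b + mul (lie a b) c - mul (lie a c) b
      - mul a (lie b c) = 0

/-- `(V, mul, lie)` is a Gel'fand-Dorfman bialgebra. -/
def IsGD (mul lie : V → V → V) : Prop :=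
  IsNovikov mul ∧ IsLieBracket lie ∧ GDcompat mul lie

/-- `I` is a Gel'fand-Dorfman ideal of `(V, mul, lie)`. -/
def IsGDIdeal (mul lie : V → V → V) (I : Submodule ℂ V) : Prop :=
  IsNovikovIdeal mul I ∧ ∀ a ∈ I, ∀ b : V, lie a b ∈ I ∧ lie b a ∈ I

/-- The symmetrized (Novikov-Jordan) product `a ∗ b = a∘b + b∘a`. -/
def sProd (mul : V → V → V) (a b : V) : V := mul a b + mul b a

/-- `I` is an ideal of the Novikov-Jordan algebra `(V, ∗)`. -/
def IsNJIdeal (mul : V → V → V) (I : Submodule ℂ V) : Prop :=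
  ∀ a ∈ I, ∀ b : V, sProd mul a b ∈ I

/-- The Novikov-Jordan algebra `(V, ∗)` is simple. -/
def NJSimple (mul : V → V → V) : Prop :=
  (∃ a b : V, sProd mul a b ≠ 0) ∧
  ∀ I : Submodule ℂ V, IsNJIdeal mul I → I = ⊥ ∨ I = ⊤

/-- An element of the free module `R = ℂ[∂]V`, recorded by its coefficients:
`a : Conf V` represents `∑ₘ ∂^m (a m)`. -/
abbrev Conf (V : Type) [Zero V] := ℕ →₀ V

/-- A polynomial in `λ` with coefficients in `R = ℂ[∂]V`: `P : LP V`
represents `∑ₙ λ^n (P n)`. -/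
abbrev LP (V : Type) [Zero V] := ℕ →₀ (ℕ →₀ V)

/-- Multiplication by `∂` on `ℂ[∂]V`. -/
noncomputable def Dop (a : Conf V) : Conf V := Finsupp.mapDomain (· + 1) a

/-- Multiplication by `λ` on `λ`-polynomials. -/
noncomputable def lmul (P : LP V) : LP V := Finsupp.mapDomain (· + 1) P

/-- Multiplication by `∂` on `λ`-polynomials. -/
noncomputable def dmul (P : LP V) : LP V := Finsupp.mapRange (Dop (V := V)) (by simp [Dop]) P

/-- Multiplication by `λ + ∂` on `λ`-polynomials. -/
noncomputable def ldOp (P : LP V) : LP V := lmul P + dmul P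

/-- The `λ`-bracket on `R = ℂ[∂]V` obtained from the generator values `B u v`
(`u, v ∈ V`) by extension via `ℂ`-bilinearity and conformal sesquilinearity:
`[(∂^m u) λ (∂^n v)] = (-λ)^m (λ+∂)^n [u λ v]`. -/
noncomputable def qbr (B : V → V → LP V) (a b : Conf V) : LP V :=
  Finsupp.sum a fun m am => Finsupp.sum b fun n bn =>
    ((-1 : ℂ) ^ m) • (lmul (V := V))^[m] ((ldOp (V := V))^[n] (B am bn))

/-- The substitution `λ ↦ -λ-∂` in a `λ`-polynomial
(used to express skew-symmetry `[a λ b] = -[b (-λ-∂) a]`). -/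
noncomputable def nsubst (P : LP V) : LP V :=
  Finsupp.sum P fun n cn => ((-1 : ℂ) ^ n) • (ldOp (V := V))^[n] (Finsupp.single 0 cn)

/-- `I` is an ideal of `R = ℂ[∂]V` with `λ`-bracket `qbr B`: a
`ℂ[∂]`-submodule (a `ℂ`-submodule closed under `∂`) such that every
`λ`-coefficient of `[a λ x]` lies in `I` for all `a ∈ R`, `x ∈ I`. -/
def IsConfIdeal (B : V → V → LP V) (I : Submodule ℂ (Conf V)) : Prop :=
  (∀ x ∈ I, Dop x ∈ I) ∧
  (∀ a : Conf V, ∀ x ∈ I, ∀ n : ℕ, qbr B a x n ∈ I)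

/-- The conformal algebra `R = ℂ[∂]V` with `λ`-bracket `qbr B` is simple:
its `λ`-bracket is not identically zero and its only ideals are `0` and `R`. -/
def ConfSimple (B : V → V → LP V) : Prop :=
  (∃ a b : Conf V, qbr B a b ≠ 0) ∧
  ∀ I : Submodule ℂ (Conf V), IsConfIdeal B I → I = ⊥ ∨ I = ⊤

/-- `R = ℂ[∂]V` with the `λ`-bracket `qbr B` is a Lie conformal algebra: the
bracket is `ℂ`-bilinear, satisfies conformal sesquilinearity, skew-symmetry
`[a λ b] = -[b (-λ-∂) a]`, and the Jacobi identity
`[a λ [b μ c]] = [[a λ b] (λ+μ) c] + [b μ [a λ c]]` (the latter written out by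
comparing the coefficients of `λ^p μ^q` on both sides). -/
def IsLieConf (B : V → V → LP V) : Prop :=
  (∀ a b c : Conf V, qbr B (a + b) c = qbr B a c + qbr B b c) ∧
  (∀ a b c : Conf V, qbr B a (b + c) = qbr B a b + qbr B a c) ∧
  (∀ (k : ℂ) (a b : Conf V), qbr B (k • a) b = k • qbr B a b) ∧
  (∀ (k : ℂ) (a b : Conf V), qbr B a (k • b) = k • qbr B a b) ∧
  (∀ a b : Conf V, qbr B (Dop a) b = - lmul (qbr B a b)) ∧
  (∀ a b : Conf V, qbr B a (Dop b) = ldOp (qbr B a b)) ∧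
  (∀ a b : Conf V, qbr B a b = - nsubst (qbr B b a)) ∧
  (∀ a b c : Conf V, ∀ p q : ℕ,
    qbr B a (qbr B b c q) p =
      (∑ n ∈ Finset.Icc q (p + q),
        (n.choose q : ℂ) • qbr B (qbr B a b (p + q - n)) c n)
      + qbr B b (qbr B a c p) q)

/-- Generator values of the `λ`-bracket of the quadratic Lie conformal algebra
associated to a Gel'fand-Dorfman bialgebra `(V, mul, lie)`:
`[u λ v] = ∂(v∘u) + [v,u] + λ(u∘v + v∘u)`. -/
noncomputable def gdB (mul lie : V → V → V) (u v : V) : LP V :=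
  Finsupp.single 0 (Finsupp.single 1 (mul v u) + Finsupp.single 0 (lie v u))
    + Finsupp.single 1 (Finsupp.single 0 (mul u v + mul v u))

end QLCA

open QLCA

/-- The basis vector `x_{α,i}` of `A₃`. -/
noncomputable def x3 (Δ : AddSubgroup ℂ) (α : Δ) (i : ℕ) : (Δ × ℕ) →₀ ℂ :=
  Finsupp.single (α, i) 1


/-- Generator values of the `λ`-bracket of `CL₃(b,φ,c)` on the basis
`x_{α,i}` (with `p = (α,i)`, `q = (β,j)`), extended bilinearly. -/
noncomputable def B3 (Δ : AddSubgroup ℂ) (b : ℂ) (φ : Δ →+ ℂ) (c : ℂ)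
    (u v : (Δ × ℕ) →₀ ℂ) : ℕ →₀ (ℕ →₀ ((Δ × ℕ) →₀ ℂ)) :=
  Finsupp.sum u fun p up => Finsupp.sum v fun q vq => (up * vq) •
    (Finsupp.single 0
        (Finsupp.single 1
            (((p.1 : ℂ) + b) • x3 Δ (p.1 + q.1) (p.2 + q.2)
              + (p.2 : ℂ) • x3 Δ (p.1 + q.1) (p.2 + q.2 - 1))
          + Finsupp.single 0
              (((1 / b) * (((q.1 : ℂ) + b) * φ p.1 - ((p.1 : ℂ) + b) * φ q.1))
                  • x3 Δ (p.1 + q.1) (p.2 + q.2)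
                + ((1 / b) * ((q.2 : ℂ) * (φ p.1 - c * ((p.1 : ℂ) + b))
                    + (p.2 : ℂ) * (c * ((q.1 : ℂ) + b) - φ q.1)))
                  • x3 Δ (p.1 + q.1) (p.2 + q.2 - 1)))
      + Finsupp.single 1
          (Finsupp.single 0
            (((p.1 : ℂ) + (q.1 : ℂ) + 2 * b) • x3 Δ (p.1 + q.1) (p.2 + q.2)
              + ((p.2 : ℂ) + (q.2 : ℂ)) • x3 Δ (p.1 + q.1) (p.2 + q.2 - 1))))

namespace QLCA

section Generic
variable {V : Type} [AddCommGroup V] [Module ℂ V]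

noncomputable def DL : Conf V →ₗ[ℂ] Conf V := Finsupp.lmapDomain V ℂ (· + 1)
noncomputable def lmL : LP V →ₗ[ℂ] LP V := Finsupp.lmapDomain (Conf V) ℂ (· + 1)
noncomputable def dmL : LP V →ₗ[ℂ] LP V := Finsupp.mapRange.linearMap DL
noncomputable def ldL : LP V →ₗ[ℂ] LP V := lmL + dmL

lemma Dop_eq : (Dop : Conf V → Conf V) = DL := rfl
lemma lmul_eq : (lmul : LP V → LP V) = lmL := rfl
lemma dmul_eq : (dmul : LP V → LP V) = dmL := rfl
lemma ldOp_eq : (ldOp : LP V → LP V) = ldL := rfl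

@[simp] lemma DL_single (n : ℕ) (v : V) : DL (Finsupp.single n v) = Finsupp.single (n+1) v := by
  simp [DL, Finsupp.mapDomain_single]
@[simp] lemma lmL_single (n : ℕ) (v : Conf V) :
    lmL (Finsupp.single n v) = Finsupp.single (n+1) v := by
  simp [lmL, Finsupp.mapDomain_single]
@[simp] lemma dmL_single (n : ℕ) (v : Conf V) :
    dmL (Finsupp.single n v) = Finsupp.single n (DL v) := by
  simp [dmL]
@[simp] lemma lmL_zero_apply (P : LP V) : lmL P 0 = 0 := by
  simp only [lmL, Finsupp.lmapDomain_apply]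
  exact Finsupp.mapDomain_of_notMem_range _ _ (by simp)
@[simp] lemma lmL_succ_apply (P : LP V) (n : ℕ) : lmL P (n+1) = P n := by
  simp only [lmL, Finsupp.lmapDomain_apply]
  exact Finsupp.mapDomain_apply (f := (· + 1)) (add_left_injective 1) P n
@[simp] lemma dmL_apply (P : LP V) (n : ℕ) : dmL P n = DL (P n) := by
  simp [dmL]
@[simp] lemma DL_zero_apply (P : Conf V) : DL P 0 = 0 := by
  simp only [DL, Finsupp.lmapDomain_apply]
  exact Finsupp.mapDomain_of_notMem_range _ _ (by simp)
@[simp] lemma DL_succ_apply (P : Conf V) (n : ℕ) : DL P (n+1) = P n := by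
  simp only [DL, Finsupp.lmapDomain_apply]
  exact Finsupp.mapDomain_apply (f := (· + 1)) (add_left_injective 1) P n
lemma ldL_apply' (P : LP V) : ldL P = lmL P + dmL P := rfl
@[simp] lemma ldL_zero_apply (P : LP V) : ldL P 0 = DL (P 0) := by simp [ldL_apply']
@[simp] lemma ldL_succ_apply (P : LP V) (n : ℕ) : ldL P (n+1) = P n + DL (P (n+1)) := by
  simp [ldL_apply']

lemma lm_dm_comm (P : LP V) : lmL (dmL P) = dmL (lmL P) := by
  ext1 n; cases n <;> simp
lemma lm_ld_comm (P : LP V) : lmL (ldL P) = ldL (lmL P) := by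
  simp [ldL_apply', lm_dm_comm]
lemma ld_dm_comm (P : LP V) : ldL (dmL P) = dmL (ldL P) := by
  simp [ldL_apply', lm_dm_comm]

/-- induction over `ℂ[∂]V`. -/
lemma conf_ind {p : Conf V → Prop} (h0 : ∀ v, p (Finsupp.single 0 v))
    (hadd : ∀ a b, p a → p b → p (a + b)) (hD : ∀ a, p a → p (DL a)) (a : Conf V) : p a := by
  have hs : ∀ n v, p (Finsupp.single n v) := by
    intro n v
    induction n with
    | zero => exact h0 v
    | succ n ih => simpa using hD _ ih
  induction a using Finsupp.induction_linear with
  | zero => simpa using h0 0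
  | add f g hf hg => exact hadd _ _ hf hg
  | single n v => exact hs n v

noncomputable def QL (B : V →ₗ[ℂ] V →ₗ[ℂ] LP V) : Conf V →ₗ[ℂ] Conf V →ₗ[ℂ] LP V :=
  Finsupp.lsum ℂ fun m => LinearMap.flip (Finsupp.lsum ℂ fun n => LinearMap.flip
    (B.compr₂ (((-1 : ℂ)^m) • (lmL ^ m * ldL ^ n))))

lemma qbr_eq (B : V →ₗ[ℂ] V →ₗ[ℂ] LP V) (a b : Conf V) :
    qbr (fun u v => B u v) a b = QL B a b := by
  unfold qbr QL
  rw [Finsupp.lsum_apply, Finsupp.sum, Finsupp.sum, LinearMap.sum_apply]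
  refine Finset.sum_congr rfl fun m _ => ?_
  rw [LinearMap.flip_apply, Finsupp.lsum_apply, Finsupp.sum, Finsupp.sum, LinearMap.sum_apply]
  refine Finset.sum_congr rfl fun n _ => ?_
  simp [Module.End.pow_apply, lmul_eq, ldOp_eq]

lemma QL_single (B : V →ₗ[ℂ] V →ₗ[ℂ] LP V) (m n : ℕ) (u v : V) :
    QL B (Finsupp.single m u) (Finsupp.single n v)
      = ((-1 : ℂ)^m) • (lmL ^ m) ((ldL ^ n) (B u v)) := by
  simp [QL]

@[simp] lemma QL_single_zero (B : V →ₗ[ℂ] V →ₗ[ℂ] LP V) (u v : V) :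
    QL B (Finsupp.single 0 u) (Finsupp.single 0 v) = B u v := by
  simp [QL_single]

lemma ldL_pow_lmL (n : ℕ) (P : LP V) : (ldL ^ n) (lmL P) = lmL ((ldL ^ n) P) := by
  induction n with
  | zero => simp
  | succ n ih => simp [pow_succ', ih, lm_ld_comm]

lemma lmL_pow_ldL (n : ℕ) (P : LP V) : (lmL ^ n) (ldL P) = ldL ((lmL ^ n) P) := by
  induction n with
  | zero => simp
  | succ n ih => simp [pow_succ', ih, lm_ld_comm]

lemma ldL_pow_dmL (n : ℕ) (P : LP V) : (ldL ^ n) (dmL P) = dmL ((ldL ^ n) P) := by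
  induction n with
  | zero => simp
  | succ n ih => simp [pow_succ', ih, ld_dm_comm]

@[simp] lemma QL_DL_left (B : V →ₗ[ℂ] V →ₗ[ℂ] LP V) (a b : Conf V) :
    QL B (DL a) b = - lmL (QL B a b) := by
  induction a using Finsupp.induction_linear with
  | zero => simp
  | add f g hf hg => simp [hf, hg]; abel
  | single m u =>
    induction b using Finsupp.induction_linear with
    | zero => simp
    | add f g hf hg => rw [map_add, hf, hg, map_add, map_add, neg_add]
    | single n v => simp [QL_single, pow_succ']

@[simp] lemma QL_DL_right (B : V →ₗ[ℂ] V →ₗ[ℂ] LP V) (a b : Conf V) :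
    QL B a (DL b) = ldL (QL B a b) := by
  induction a using Finsupp.induction_linear with
  | zero => simp
  | add f g hf hg => simp [hf, hg]
  | single m u =>
    induction b using Finsupp.induction_linear with
    | zero => simp
    | add f g hf hg => simp [hf, hg]
    | single n v => simp [QL_single, pow_succ', lmL_pow_ldL]

noncomputable def nsL : LP V →ₗ[ℂ] LP V :=
  Finsupp.lsum ℂ fun n => (((-1 : ℂ)^n) • (ldL ^ n)) ∘ₗ Finsupp.lsingle 0

lemma nsubst_eq (P : LP V) : nsubst P = nsL P := by
  unfold nsubst nsL
  rw [Finsupp.lsum_apply]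
  refine Finset.sum_congr rfl fun n _ => ?_
  simp [Module.End.pow_apply, ldOp_eq]

lemma nsL_single (n : ℕ) (c : Conf V) :
    nsL (Finsupp.single n c) = ((-1 : ℂ)^n) • (ldL ^ n) (Finsupp.single 0 c) := by
  simp [nsL]

lemma nsL_lmL (P : LP V) : nsL (lmL P) = - ldL (nsL P) := by
  induction P using Finsupp.induction_linear with
  | zero => simp
  | add f g hf hg => simp [hf, hg]; abel
  | single n c => simp [nsL_single, pow_succ']

lemma nsL_dmL (P : LP V) : nsL (dmL P) = dmL (nsL P) := by
  induction P using Finsupp.induction_linear with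
  | zero => simp
  | add f g hf hg => simp [hf, hg]
  | single n c =>
    rw [dmL_single, nsL_single, nsL_single, ← dmL_single, ldL_pow_dmL, map_smul]

lemma nsL_ldL (P : LP V) : nsL (ldL P) = - lmL (nsL P) := by
  rw [ldL_apply', map_add, nsL_lmL, nsL_dmL, ldL_apply']; abel

lemma skew_of_gen (B : V →ₗ[ℂ] V →ₗ[ℂ] LP V) (h : ∀ u v, B u v = - nsL (B v u))
    (a b : Conf V) : QL B a b = - nsL (QL B b a) := by
  induction a using conf_ind with
  | hadd a a' ha ha' => simp [ha, ha']; abel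
  | hD a ha => rw [QL_DL_left, QL_DL_right, nsL_ldL, ha]; simp
  | h0 u =>
    induction b using conf_ind with
    | hadd a a' ha ha' => simp [ha, ha']; abel
    | hD a ha => rw [QL_DL_left, QL_DL_right, map_neg, nsL_lmL, ha]; simp
    | h0 v => simpa using h u v

/-- The middle sum in the Jacobi identity. -/
noncomputable def JS (Y : ℕ → ℕ → Conf V) (p q : ℕ) : Conf V :=
  ∑ k ∈ Finset.range (p+1), ((q+k).choose q : ℂ) • Y (p-k) (q+k)

lemma JS_Icc (Y : ℕ → ℕ → Conf V) (p q : ℕ) :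
    (∑ n ∈ Finset.Icc q (p + q), (n.choose q : ℂ) • Y (p+q-n) n) = JS Y p q := by
  rw [JS, ← Finset.Ico_add_one_right_eq_Icc, Finset.sum_Ico_eq_sum_range]
  have : p + q + 1 - q = p + 1 := by omega
  rw [this]
  refine Finset.sum_congr rfl fun k hk => ?_
  have : p + q - (q + k) = p - k := by omega
  rw [this]

lemma JS_add (Y Z : ℕ → ℕ → Conf V) (p q : ℕ) :
    JS (fun i n => Y i n + Z i n) p q = JS Y p q + JS Z p q := by
  simp [JS, Finset.sum_add_distrib]

lemma JS_neg (Y : ℕ → ℕ → Conf V) (p q : ℕ) :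
    JS (fun i n => - Y i n) p q = - JS Y p q := by
  simp [JS]

lemma JS_DL (Y : ℕ → ℕ → Conf V) (p q : ℕ) :
    JS (fun i n => DL (Y i n)) p q = DL (JS Y p q) := by
  simp [JS]

/-- shift in the first index -/
def sh1 (Y : ℕ → ℕ → Conf V) (i n : ℕ) : Conf V := match i with
  | 0 => 0
  | i+1 => Y i n

def sh2 (Y : ℕ → ℕ → Conf V) (i n : ℕ) : Conf V := match n with
  | 0 => 0
  | n+1 => Y i n

lemma JS_sh1 (Y : ℕ → ℕ → Conf V) (p q : ℕ) : JS (sh1 Y) p q = sh1 (JS Y) p q := by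
  cases p with
  | zero => simp [JS, sh1]
  | succ p =>
    rw [JS, Finset.sum_range_succ]
    simp only [sh1, tsub_self, smul_zero, add_zero, JS]
    refine Finset.sum_congr rfl fun k hk => ?_
    have : p + 1 - k = (p - k) + 1 := by have := Finset.mem_range.1 hk; omega
    rw [this]

lemma JS_sh2 (Y : ℕ → ℕ → Conf V) (p q : ℕ) :
    JS (sh2 Y) p q = sh2 (JS Y) p q + sh1 (JS Y) p q := by
  cases q with
  | zero =>
    cases p with
    | zero => simp [JS, sh1, sh2]
    | succ p =>
      rw [JS, Finset.sum_range_succ']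
      simp [sh1, sh2, JS]
  | succ q =>
    have e : JS (sh2 Y) p (q+1) = ∑ k ∈ Finset.range (p+1),
        (((q+k).choose q : ℂ) • Y (p-k) (q+k) + ((q+k).choose (q+1) : ℂ) • Y (p-k) (q+k)) := by
      refine Finset.sum_congr rfl fun k hk => ?_
      have : q + 1 + k = q + k + 1 := by omega
      rw [this, Nat.choose_succ_succ, ← add_smul]
      simp [sh2]
    rw [e, Finset.sum_add_distrib]
    congr 1
    cases p with
    | zero => simp [sh1]
    | succ p =>
      rw [Finset.sum_range_succ']
      simp [sh1, JS]
      refine Finset.sum_congr rfl fun k hk => ?_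
      have : q + 1 + k = q + (k + 1) := by omega
      rw [this]

def Jac (B : V →ₗ[ℂ] V →ₗ[ℂ] LP V) (a b c : Conf V) : Prop :=
  ∀ p q, QL B a (QL B b c q) p =
    JS (fun i n => QL B (QL B a b i) c n) p q + QL B b (QL B a c p) q

lemma lmL_apply_sh (P : ℕ → LP V) (i n : ℕ) : lmL (P i) n = sh2 (fun i n => P i n) i n := by
  cases n <;> simp [sh2]

lemma jac_of_gen (B : V →ₗ[ℂ] V →ₗ[ℂ] LP V)
    (h : ∀ u v w, Jac B (Finsupp.single 0 u) (Finsupp.single 0 v) (Finsupp.single 0 w))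
    (a b c : Conf V) : Jac B a b c := by
  induction a using conf_ind with
  | hadd a a' ha ha' =>
    intro p q
    have := congrArg₂ (· + ·) (ha p q) (ha' p q)
    simp only [map_add, LinearMap.add_apply, Finsupp.add_apply, JS_add, this]; abel
  | hD a ha =>
    intro p q
    have e : JS (fun i n => QL B (QL B (DL a) b i) c n) p q
        = - sh1 (JS (fun i n => QL B (QL B a b i) c n)) p q := by
      rw [← JS_sh1, ← JS_neg]; congr 1; funext i n
      cases i <;> simp [sh1]
    rw [e]
    cases p with
    | zero => simp [sh1]
    | succ p => simp [sh1, ha p q]; abel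
  | h0 u =>
  induction b using conf_ind with
  | hadd a a' ha ha' =>
    intro p q
    have := congrArg₂ (· + ·) (ha p q) (ha' p q)
    simp only [map_add, LinearMap.add_apply, Finsupp.add_apply, JS_add, this]; abel
  | hD b hb =>
    intro p q
    set a := Finsupp.single 0 u with haa
    have e : JS (fun i n => QL B (QL B a (DL b) i) c n) p q
        = - sh2 (JS (fun i n => QL B (QL B a b i) c n)) p q := by
      have : (fun i n => QL B (QL B a (DL b) i) c n) = (fun i n =>
          sh1 (fun i n => QL B (QL B a b i) c n) i n +
          - (sh2 (fun i n => QL B (QL B a b i) c n) i n)) := by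
        funext i n
        cases i <;> cases n <;> simp [sh1, sh2]
      rw [this, JS_add, JS_neg]
      change JS (sh1 _) p q + - JS (sh2 _) p q = _
      rw [JS_sh1, JS_sh2]; abel
    rw [e]
    cases q with
    | zero => simp [sh2]
    | succ q => simp [sh2, hb p q]; abel
  | h0 v =>
  induction c using conf_ind with
  | hadd a a' ha ha' =>
    intro p q
    have := congrArg₂ (· + ·) (ha p q) (ha' p q)
    simp only [map_add, Finsupp.add_apply, JS_add, this]; abel
  | h0 w => exact h u v w
  | hD c hc =>
    intro p q
    set a := Finsupp.single 0 u with haa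
    set b := Finsupp.single 0 v with hbb
    have e : JS (fun i n => QL B (QL B a b i) (DL c) n) p q
        = sh2 (JS (fun i n => QL B (QL B a b i) c n)) p q
         + sh1 (JS (fun i n => QL B (QL B a b i) c n)) p q
         + DL (JS (fun i n => QL B (QL B a b i) c n) p q) := by
      have : (fun i n => QL B (QL B a b i) (DL c) n) = (fun i n =>
          (sh2 (fun i n => QL B (QL B a b i) c n) i n) + DL (QL B (QL B a b i) c n)) := by
        funext i n
        cases n <;> simp [sh2]
      rw [this, JS_add, JS_DL]
      change JS (sh2 _) p q + _ = _
      rw [JS_sh2]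
    rw [e]
    cases p <;> cases q <;> simp [sh1, sh2, hc _ _] <;> abel

lemma isLieConf_of_gen (B : V →ₗ[ℂ] V →ₗ[ℂ] LP V) (hs : ∀ u v, B u v = - nsL (B v u))
    (h : ∀ u v w, Jac B (Finsupp.single 0 u) (Finsupp.single 0 v) (Finsupp.single 0 w)) :
    IsLieConf (fun u v => B u v) := by
  refine ⟨?_, ?_, ?_, ?_, ?_, ?_, ?_, ?_⟩
  · intro a b c; simp [qbr_eq]
  · intro a b c; simp [qbr_eq]
  · intro a b c; simp [qbr_eq]
  · intro a b c; simp [qbr_eq]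
  · intro a b; simp [qbr_eq, Dop_eq, lmul_eq]
  · intro a b; simp [qbr_eq, Dop_eq, ldOp_eq]
  · intro a b; rw [qbr_eq, qbr_eq, nsubst_eq]; exact skew_of_gen B hs a b
  · intro a b c p q
    simp only [qbr_eq]
    rw [JS_Icc (fun i n => QL B (QL B a b i) c n)]
    exact jac_of_gen B h a b c p q

end Generic
end QLCA
namespace QLCA
section Alg
variable {A : Type} [CommRing A] [Algebra ℂ A] (D E : Derivation ℂ A A) (r : ℂ)

/-- `T = D + r`. -/
noncomputable def TT : A →ₗ[ℂ] A := (D : A →ₗ[ℂ] A) + r • LinearMap.id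

lemma TT_apply (u : A) : TT D r u = D u + algebraMap ℂ A r * u := by
  simp [TT, Algebra.smul_def]

/-- The bracket on generators. -/
noncomputable def BA : A →ₗ[ℂ] A →ₗ[ℂ] LP A :=
  ((LinearMap.mul ℂ A).flip.comp (TT D r)).compr₂
      ((Finsupp.lsingle 0).comp (Finsupp.lsingle 1))
  + (((LinearMap.mul ℂ A).comp (E : A →ₗ[ℂ] A)).compl₂ (TT D r)
      - ((LinearMap.mul ℂ A).comp (TT D r)).compl₂ (E : A →ₗ[ℂ] A)).compr₂
      ((Finsupp.lsingle 0).comp (Finsupp.lsingle 0))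
  + ((LinearMap.mul ℂ A).compl₂ (TT D r) + (LinearMap.mul ℂ A).flip.comp (TT D r)).compr₂
      ((Finsupp.lsingle 1).comp (Finsupp.lsingle 0))

lemma BA_apply (u v : A) : BA D E r u v =
    Finsupp.single 0 (Finsupp.single 1 (v * TT D r u)
      + Finsupp.single 0 (E u * TT D r v - TT D r u * E v))
    + Finsupp.single 1 (Finsupp.single 0 (u * TT D r v + v * TT D r u)) := by
  rw [Finsupp.single_add]
  rfl

lemma BA_zero (u v : A) : BA D E r u v 0 = DL (Finsupp.single 0 (v * TT D r u))
      + Finsupp.single 0 (E u * TT D r v - TT D r u * E v) := by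
  rw [BA_apply, DL_single]
  simp [-Finsupp.single_mul]
lemma BA_one (u v : A) : BA D E r u v 1 = Finsupp.single 0 (u * TT D r v + v * TT D r u) := by
  simp [BA_apply, -Finsupp.single_mul]
lemma BA_one' (u v : A) : BA D E r u v (0+1) =
    Finsupp.single 0 (u * TT D r v + v * TT D r u) := BA_one D E r u v
lemma BA_two (u v : A) (n : ℕ) : BA D E r u v (n+1+1) = 0 := by
  rw [BA_apply, Finsupp.add_apply, Finsupp.single_apply, Finsupp.single_apply,
    if_neg (by omega), if_neg (by omega), add_zero]

lemma BA_skew (u v : A) : BA D E r u v = - nsL (BA D E r v u) := by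
  rw [BA_apply D E r v u, map_add, nsL_single, nsL_single]
  ext1 n
  rcases n with _ | _ | n
  · simp only [BA_zero]
    ext n
    rcases n with _ | _ | n <;> simp; ring
  · simp only [BA_one', zero_add]
    simp [ldL_apply']
  · rw [BA_two]
    simp [ldL_apply']

lemma BA_Y_zero (u v w : A) (i n : ℕ) (h : 3 ≤ i + n) :
    QL (BA D E r) (BA D E r u v i) (Finsupp.single 0 w) n = 0 := by
  rcases i with _ | _ | i
  · obtain ⟨n, rfl⟩ : ∃ m, n = m + 1 + 1 + 1 := ⟨n - 3, by omega⟩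
    simp only [BA_zero, map_add, LinearMap.add_apply, QL_DL_left, QL_single_zero,
      Finsupp.add_apply, Finsupp.neg_apply, lmL_succ_apply, BA_two]
    simp
  · obtain ⟨n, rfl⟩ : ∃ m, n = m + 1 + 1 := ⟨n - 2, by omega⟩
    simp only [BA_one', QL_single_zero, BA_two]
  · simp [BA_two]

lemma BA_L_zero (u v w : A) (i n : ℕ) (h : 3 ≤ i + n) :
    QL (BA D E r) (Finsupp.single 0 w) (BA D E r u v i) n = 0 := by
  rcases i with _ | _ | i
  · obtain ⟨n, rfl⟩ : ∃ m, n = m + 1 + 1 + 1 := ⟨n - 3, by omega⟩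
    simp only [BA_zero, map_add, QL_DL_right, QL_single_zero,
      Finsupp.add_apply, ldL_succ_apply, BA_two]
    simp
  · obtain ⟨n, rfl⟩ : ∃ m, n = m + 1 + 1 := ⟨n - 2, by omega⟩
    simp only [BA_one', QL_single_zero, BA_two]
  · simp [BA_two]

lemma BA_jac (hDE : ∀ x, D (E x) = E (D x)) (u v w : A) :
    Jac (BA D E r) (Finsupp.single 0 u) (Finsupp.single 0 v) (Finsupp.single 0 w) := by
  intro p q
  simp only [QL_single_zero]
  by_cases hpq : 3 ≤ p + q
  · rw [BA_L_zero _ _ _ _ _ _ _ _ (by omega), BA_L_zero _ _ _ _ _ _ _ _ (by omega), JS,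
      Finset.sum_eq_zero, add_zero]
    intro k hk
    have := Finset.mem_range.1 hk
    rw [BA_Y_zero _ _ _ _ _ _ _ _ (by omega), smul_zero]
  · have hc : (p = 0 ∧ q = 0) ∨ (p = 0 ∧ q = 1) ∨ (p = 1 ∧ q = 0) ∨ (p = 1 ∧ q = 1) ∨
      (p = 0 ∧ q = 2) ∨ (p = 2 ∧ q = 0) := by omega
    have s0 : ∀ x : A, (Finsupp.single 0 x : Conf A) 0 = x := fun x => by simp
    have s1 : ∀ (x : A) (n : ℕ), (Finsupp.single 0 x : Conf A) (n + 1) = 0 := fun x n => by simp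
    have b2 : ∀ u v, BA D E r u v 2 = 0 := fun u v => BA_two D E r u v 0
    have l1 : ∀ P : LP A, lmL P 1 = P 0 := fun P => lmL_succ_apply P 0
    have l2 : ∀ P : LP A, lmL P 2 = P 1 := fun P => lmL_succ_apply P 1
    have d1 : ∀ P : LP A, ldL P 1 = P 0 + DL (P 1) := fun P => ldL_succ_apply P 0
    have d2 : ∀ P : LP A, ldL P 2 = P 1 + DL (P 2) := fun P => ldL_succ_apply P 1
    rcases hc with ⟨rfl, rfl⟩ | ⟨rfl, rfl⟩ | ⟨rfl, rfl⟩ | ⟨rfl, rfl⟩ | ⟨rfl, rfl⟩ | ⟨rfl, rfl⟩ <;>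
    simp only [JS, Finset.sum_range_succ, Finset.sum_range_zero, zero_add, tsub_zero, add_zero,
      Nat.choose_zero_right, Nat.choose_self, Nat.sub_self, Nat.cast_one, one_smul,
      BA_zero, BA_one, b2, map_add, LinearMap.add_apply, QL_DL_left, QL_DL_right, QL_single_zero,
      Finsupp.add_apply, Finsupp.neg_apply, lmL_zero_apply, l1, l2, d1, d2, ldL_zero_apply,
      map_zero, LinearMap.zero_apply, Finsupp.zero_apply, neg_zero,
      Nat.reduceAdd, Nat.reduceSub, Nat.choose_one_right] <;>
    (ext n
     rcases n with _ | _ | _ | n <;>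
     simp only [s0, s1, Finsupp.add_apply, Finsupp.neg_apply, DL_succ_apply, DL_zero_apply,
       TT_apply, map_add, map_sub, Derivation.leibniz, smul_eq_mul, Derivation.map_algebraMap,
       hDE, zero_add, Nat.cast_ofNat, two_smul, Finsupp.coe_zero, Pi.zero_apply] <;> ring)

lemma BA_isLieConf (hDE : ∀ x, D (E x) = E (D x)) :
    IsLieConf (fun u v => BA D E r u v) :=
  isLieConf_of_gen _ (BA_skew D E r) (BA_jac D E r hDE)

end Alg
end QLCA
namespace QLCA
section Simp
variable {A : Type} [CommRing A] [Algebra ℂ A] (D E : Derivation ℂ A A) (r : ℂ)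

/-- `S = D + 2 r`. -/
noncomputable def SS : A →ₗ[ℂ] A := (D : A →ₗ[ℂ] A) + (2 * r) • LinearMap.id

lemma SS_apply (u : A) : SS D r u = D u + (2 * r) • u := rfl

lemma SS_mul (u v : A) : u * TT D r v + v * TT D r u = SS D r (u * v) := by
  simp only [TT_apply, SS_apply, Derivation.leibniz, smul_eq_mul, Algebra.smul_def, map_mul,
    map_ofNat]
  ring

lemma conf_decomp (x : Conf A) : ∃ x' : Conf A, x = Finsupp.single 0 (x 0) + DL x' := by
  refine ⟨Finsupp.comapDomain (· + 1) x (add_left_injective 1).injOn, ?_⟩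
  ext n
  cases n <;> simp [Finsupp.comapDomain_apply]

lemma QL_top (u : A) (N : ℕ) : ∀ x : Conf A, (∀ n, N < n → x n = 0) →
    QL (BA D E r) (Finsupp.single 0 u) x (N+1) = Finsupp.single 0 (SS D r (u * x N)) ∧
    ∀ n, N + 2 ≤ n → QL (BA D E r) (Finsupp.single 0 u) x n = 0 := by
  induction N with
  | zero =>
    intro x hx
    have hx' : x = Finsupp.single 0 (x 0) := by
      ext n
      cases n with
      | zero => simp
      | succ n => simp [hx (n+1) (by omega)]
    rw [hx']
    simp only [QL_single_zero, Finsupp.single_eq_same]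
    refine ⟨by rw [BA_one', SS_mul], fun n hn => ?_⟩
    obtain ⟨m, rfl⟩ : ∃ m, n = m + 1 + 1 := ⟨n - 2, by omega⟩
    exact BA_two ..
  | succ N ih =>
    intro x hx
    obtain ⟨x', h⟩ := conf_decomp x
    have hxx : ∀ n, x' n = x (n+1) := fun n => by rw [h]; simp
    obtain ⟨h1, h2⟩ := ih x' (fun n hn => by rw [hxx]; exact hx _ (by omega))
    have key : ∀ n, QL (BA D E r) (Finsupp.single 0 u) x (n+1+1) =
        QL (BA D E r) (Finsupp.single 0 u) x' (n+1) +
        DL (QL (BA D E r) (Finsupp.single 0 u) x' (n+1+1)) := by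
      intro n
      conv_lhs => rw [h]
      rw [(QL (BA D E r) (Finsupp.single 0 u)).map_add, QL_DL_right, QL_single_zero, Finsupp.add_apply, BA_two, ldL_succ_apply, zero_add]
    refine ⟨?_, fun n hn => ?_⟩
    · rw [key, h1, h2 _ (by omega), map_zero, add_zero, hxx]
    · obtain ⟨m, rfl⟩ : ∃ m, n = m + 1 + 1 := ⟨n - 2, by omega⟩
      rw [key, h2 _ (by omega), h2 _ (by omega), map_zero, add_zero]

theorem BA_simple [Nontrivial A] (hsurj : ∀ x, ∃ y, SS D r y = x) (t : A) (ht : D t = 1)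
    (hid : ∀ J : Ideal A, (∀ x ∈ J, D x ∈ J) → J ≠ ⊥ → J = ⊤) :
    ConfSimple (fun u v => BA D E r u v) := by
  refine ⟨?_, ?_⟩
  · obtain ⟨y, hy⟩ := hsurj 1
    refine ⟨Finsupp.single 0 1, Finsupp.single 0 y, fun h => ?_⟩
    rw [qbr_eq, QL_single_zero] at h
    have := congrArg (fun P : LP A => P 1 0) h
    beta_reduce at this
    rw [BA_one, SS_mul, one_mul, hy] at this
    simp at this
  · intro I ⟨hD, hI⟩
    by_cases hbot : I = ⊥
    · exact Or.inl hbot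
    right
    obtain ⟨x, hxI, hx0⟩ := (Submodule.ne_bot_iff I).1 hbot
    simp only [qbr_eq] at hI
    let W : Submodule ℂ A := I.comap (Finsupp.lsingle 0)
    have memW : ∀ w, w ∈ W ↔ Finsupp.single 0 w ∈ I := fun w => Iff.rfl
    have topW : ∀ x ∈ I, ∀ N, (∀ n, N < n → x n = 0) → ∀ u, SS D r (u * x N) ∈ W := by
      intro x hx N hN u
      rw [memW, ← (QL_top D E r u N x hN).1]
      exact hI _ _ hx _
    have hW1 : ∀ w ∈ W, ∀ u, SS D r (u * w) ∈ W := by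
      intro w hw u
      have := topW _ hw 0 (fun n hn => by simp [Finsupp.single_apply]; omega) u
      simpa using this
    obtain ⟨w, hwW, hw0⟩ : ∃ w ∈ W, w ≠ 0 := by
      have hs : x.support.Nonempty := Finsupp.support_nonempty_iff.2 hx0
      have hN := x.support.max'_mem hs
      set N := x.support.max' hs with hNdef
      have hv : x N ≠ 0 := by simpa using hN
      have hgt : ∀ n, N < n → x n = 0 := by
        intro n hn
        by_contra hne
        have := x.support.le_max' n (by simpa using hne)
        omega
      have h := topW x hxI N hgt
      by_cases h1 : SS D r (x N) = 0
      · refine ⟨_, h t, ?_⟩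
        have : SS D r (t * x N) = x N + t * SS D r (x N) := by
          simp only [SS_apply, Derivation.leibniz, smul_eq_mul, ht, Algebra.smul_def]
          ring
        rw [this, h1]
        simpa using hv
      · exact ⟨_, h 1, by simpa using h1⟩
    let J : Ideal A := Ideal.span (W : Set A)
    have hJW : ∀ j ∈ J, ∀ a, SS D r (a * j) ∈ W := by
      intro j hj
      induction hj using Submodule.span_induction with
      | mem w hw => exact hW1 w hw
      | zero => intro a; simp
      | add x y _ _ hx hy => intro a; rw [mul_add, map_add]; exact W.add_mem (hx a) (hy a)
      | smul c x _ hx => intro a; rw [smul_eq_mul, ← mul_assoc]; exact hx _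
    have hJ : J = ⊤ := by
      refine hid J ?_ ?_
      · intro j hj
        have h1 : SS D r j ∈ J := Ideal.subset_span (by simpa using hJW j hj 1)
        have h2 : D j = SS D r j - algebraMap ℂ A (2 * r) * j := by
          rw [SS_apply, Algebra.smul_def]; ring
        rw [h2]
        exact J.sub_mem h1 (J.mul_mem_left _ hj)
      · intro h
        have : w ∈ J := Ideal.subset_span hwW
        rw [h] at this
        exact hw0 (by simpa using this)
    have hWt : ∀ a, a ∈ W := by
      intro a
      obtain ⟨y, rfl⟩ := hsurj a
      have : (1 : A) ∈ J := by rw [hJ]; trivial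
      simpa using hJW 1 this y
    rw [eq_top_iff]
    rintro x -
    induction x using conf_ind with
    | h0 v => exact hWt v
    | hadd a b ha hb => exact I.add_mem ha hb
    | hD a ha => exact hD a ha

end Simp
end QLCA
namespace QLCA
section Concrete
variable (Δ : AddSubgroup ℂ)

/-- The underlying space of `CL₃`, seen as the commutative algebra `ℂ[Δ][t]`. -/
def A3 : Type := (Δ × ℕ) →₀ ℂ

noncomputable instance A3.instG : AddCommGroup (A3 Δ) :=
  inferInstanceAs (AddCommGroup ((Δ × ℕ) →₀ ℂ))

variable {Δ}

noncomputable def toMA (f : A3 Δ) : AddMonoidAlgebra ℂ (Δ × ℕ) := AddMonoidAlgebra.ofCoeff f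

noncomputable instance A3.instRing : CommRing (A3 Δ) :=
  { A3.instG Δ with
    mul := fun f g => (toMA f * toMA g).coeff
    one := (1 : AddMonoidAlgebra ℂ (Δ × ℕ)).coeff
    left_distrib := fun a b c => congrArg AddMonoidAlgebra.coeff (mul_add (toMA a) (toMA b) (toMA c))
    right_distrib := fun a b c => congrArg AddMonoidAlgebra.coeff (add_mul (toMA a) (toMA b) (toMA c))
    zero_mul := fun a => congrArg AddMonoidAlgebra.coeff (zero_mul (toMA a))
    mul_zero := fun a => congrArg AddMonoidAlgebra.coeff (mul_zero (toMA a))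
    mul_assoc := fun a b c => congrArg AddMonoidAlgebra.coeff (mul_assoc (toMA a) (toMA b) (toMA c))
    one_mul := fun a => congrArg AddMonoidAlgebra.coeff (one_mul (toMA a))
    mul_one := fun a => congrArg AddMonoidAlgebra.coeff (mul_one (toMA a))
    mul_comm := fun a b => congrArg AddMonoidAlgebra.coeff (mul_comm (toMA a) (toMA b)) }

noncomputable instance A3.instMod : Module ℂ (A3 Δ) :=
  inferInstanceAs (Module ℂ ((Δ × ℕ) →₀ ℂ))

noncomputable instance A3.instAlg : Algebra ℂ (A3 Δ) :=
  Algebra.ofModule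
    (fun r x y => congrArg AddMonoidAlgebra.coeff (smul_mul_assoc r (toMA x) (toMA y)))
    (fun r x y => congrArg AddMonoidAlgebra.coeff (mul_smul_comm r (toMA x) (toMA y)))

/-- basis vector -/
noncomputable def X (α : Δ) (i : ℕ) : A3 Δ := x3 Δ α i

lemma X_mul (α β : Δ) (i j : ℕ) : X α i * X β j = X (α + β) (i + j) := by
  have := congrArg AddMonoidAlgebra.coeff
    (AddMonoidAlgebra.single_mul_single (R := ℂ) (α, i) (β, j) 1 1)
  rw [one_mul] at this
  exact this

lemma X_one : (1 : A3 Δ) = X 0 0 := rfl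

lemma A3_ind {p : A3 Δ → Prop} (h0 : p 0) (hadd : ∀ a b, p a → p b → p (a + b))
    (hs : ∀ (k : ℂ) (α : Δ) (i : ℕ), p (k • X α i)) (a : A3 Δ) : p a := by
  refine Finsupp.induction_linear (motive := p) a h0 (fun f g hf hg => hadd f g hf hg) ?_
  rintro ⟨α, i⟩ k
  have : (Finsupp.single (α, i) k : (Δ × ℕ) →₀ ℂ) = k • x3 Δ α i := by simp [x3]
  rw [this]
  exact hs k α i

/-- The linear map `x_{α,i} ↦ a(α) x_{α,i} + s i x_{α,i-1}`. -/
noncomputable def dlin (a : Δ →+ ℂ) (s : ℂ) : A3 Δ →ₗ[ℂ] A3 Δ :=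
  Finsupp.linearCombination ℂ (fun p : Δ × ℕ => a p.1 • X p.1 p.2 + (s * p.2) • X p.1 (p.2 - 1))

lemma dlin_X (a : Δ →+ ℂ) (s : ℂ) (α : Δ) (i : ℕ) :
    dlin a s (X α i) = a α • X α i + (s * i) • X α (i - 1) := by
  have := Finsupp.linearCombination_single (R := ℂ)
    (v := fun p : Δ × ℕ => a p.1 • X p.1 p.2 + (s * p.2) • X p.1 (p.2 - 1)) 1 (α, i)
  rw [one_smul] at this
  exact this

lemma dlin_leib_X (a : Δ →+ ℂ) (s : ℂ) (α β : Δ) (i j : ℕ) :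
    dlin a s (X α i * X β j) = X α i * dlin a s (X β j) + X β j * dlin a s (X α i) := by
  rw [X_mul, dlin_X, dlin_X, dlin_X, mul_add, mul_add, mul_smul_comm, mul_smul_comm,
    mul_smul_comm, mul_smul_comm, X_mul, X_mul, X_mul, X_mul, add_comm β α, add_comm j i, map_add]
  rcases i with _ | i <;> rcases j with _ | j
  · simp; module
  · simp; module
  · simp; module
  · have e1 : i + 1 + (j + 1) - 1 = i + j + 1 := by omega
    have e2 : i + 1 + (j + 1 - 1) = i + j + 1 := by omega
    have e3 : j + 1 + (i + 1 - 1) = i + j + 1 := by omega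
    rw [e1, e2, e3]
    push_cast
    module

/-- The corresponding derivation. -/
noncomputable def der (a : Δ →+ ℂ) (s : ℂ) : Derivation ℂ (A3 Δ) (A3 Δ) :=
  Derivation.mk' (dlin a s) (by
    intro f g
    simp only [smul_eq_mul]
    induction f using A3_ind with
    | h0 => simp
    | hadd f f' hf hf' => simp only [add_mul, map_add, mul_add, hf, hf']; ring
    | hs k α i =>
      induction g using A3_ind with
      | h0 => simp
      | hadd f f' hf hf' => simp only [add_mul, map_add, mul_add, hf, hf']; ring
      | hs l β j =>
        simp only [smul_mul_assoc, mul_smul_comm, map_smul, dlin_leib_X, smul_add]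
        module)

lemma der_apply (a : Δ →+ ℂ) (s : ℂ) (f : A3 Δ) : der a s f = dlin a s f := rfl

lemma der_X (a : Δ →+ ℂ) (s : ℂ) (α : Δ) (i : ℕ) :
    der a s (X α i) = a α • X α i + (s * i) • X α (i - 1) := dlin_X a s α i

lemma der_comm (a a' : Δ →+ ℂ) (s s' : ℂ) (f : A3 Δ) :
    der a s (der a' s' f) = der a' s' (der a s f) := by
  induction f using A3_ind with
  | h0 => simp
  | hadd f f' hf hf' => simp only [map_add, hf, hf']
  | hs k α i =>
    simp only [Derivation.map_smul, map_add, der_X]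
    module

variable (Δ) in
/-- The derivation `D`. -/
noncomputable def D3 : Derivation ℂ (A3 Δ) (A3 Δ) := der Δ.subtype 1

lemma D3_X (α : Δ) (i : ℕ) : D3 Δ (X α i) = (α : ℂ) • X α i + (i : ℂ) • X α (i - 1) := by
  simp [D3, der_X]

/-- The derivation `E`. -/
noncomputable def E3 (b : ℂ) (φ : Δ →+ ℂ) (c : ℂ) : Derivation ℂ (A3 Δ) (A3 Δ) :=
  der ((AddMonoidHom.mulLeft (1 / b)).comp φ) (1 / b * c)

lemma E3_X (b : ℂ) (φ : Δ →+ ℂ) (c : ℂ) (α : Δ) (i : ℕ) : E3 b φ c (X α i) =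
    (1 / b * φ α) • X α i + (1 / b * c * i) • X α (i - 1) := by
  simp [E3, der_X]

lemma T3_X (b : ℂ) (α : Δ) (i : ℕ) : TT (D3 Δ) b (X α i) =
    ((α : ℂ) + b) • X α i + (i : ℂ) • X α (i - 1) := by
  simp only [TT, LinearMap.add_apply, Derivation.coeFn_coe, LinearMap.smul_apply,
    LinearMap.id_apply, D3_X]
  module

lemma S3_X (b : ℂ) (α : Δ) (i : ℕ) : SS (D3 Δ) b (X α i) =
    ((α : ℂ) + 2 * b) • X α i + (i : ℂ) • X α (i - 1) := by
  simp only [SS_apply, D3_X]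
  module

lemma lie_X (b : ℂ) (φ : Δ →+ ℂ) (c : ℂ) (α β : Δ) (i j : ℕ) :
    E3 b φ c (X α i) * TT (D3 Δ) b (X β j) - TT (D3 Δ) b (X α i) * E3 b φ c (X β j) =
    ((1 / b) * (((β : ℂ) + b) * φ α - ((α : ℂ) + b) * φ β)) • X (α + β) (i + j)
    + ((1 / b) * ((j : ℂ) * (φ α - c * ((α : ℂ) + b))
                    + (i : ℂ) * (c * ((β : ℂ) + b) - φ β))) • X (α + β) (i + j - 1) := by
  rw [E3_X, E3_X, T3_X, T3_X]
  simp only [mul_add, add_mul, smul_mul_assoc, mul_smul_comm, X_mul]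
  rcases i with _ | i <;> rcases j with _ | j
  · simp; module
  · simp; module
  · simp; module
  · have e1 : i + 1 + (j + 1) - 1 = i + j + 1 := by omega
    have e2 : i + 1 + (j + 1 - 1) = i + j + 1 := by omega
    have e3 : i + 1 - 1 + (j + 1) = i + j + 1 := by omega
    rw [e1, e2, e3]
    module

lemma nov_X (b : ℂ) (α β : Δ) (i j : ℕ) :
    X β j * TT (D3 Δ) b (X α i) =
    ((α : ℂ) + b) • X (α + β) (i + j) + (i : ℂ) • X (α + β) (i + j - 1) := by
  rw [T3_X]
  simp only [mul_add, mul_smul_comm, X_mul]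
  rw [add_comm β α, add_comm j i]
  rcases i with _ | i
  · simp
  · have e1 : i + 1 + j - 1 = j + (i + 1 - 1) := by omega
    rw [e1]

lemma B3_eq (b : ℂ) (φ : Δ →+ ℂ) (c : ℂ) :
    (B3 Δ b φ c : A3 Δ → A3 Δ → LP (A3 Δ)) = fun u v => BA (D3 Δ) (E3 b φ c) b u v := by
  funext u v
  have hX : ∀ (p q : Δ × ℕ), BA (D3 Δ) (E3 b φ c) b (X p.1 p.2) (X q.1 q.2) =
    (Finsupp.single 0
        (Finsupp.single 1
            (((p.1 : ℂ) + b) • X (p.1 + q.1) (p.2 + q.2)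
              + (p.2 : ℂ) • X (p.1 + q.1) (p.2 + q.2 - 1))
          + Finsupp.single 0
              (((1 / b) * (((q.1 : ℂ) + b) * φ p.1 - ((p.1 : ℂ) + b) * φ q.1))
                  • X (p.1 + q.1) (p.2 + q.2)
                + ((1 / b) * ((q.2 : ℂ) * (φ p.1 - c * ((p.1 : ℂ) + b))
                    + (p.2 : ℂ) * (c * ((q.1 : ℂ) + b) - φ q.1)))
                  • X (p.1 + q.1) (p.2 + q.2 - 1)))
      + Finsupp.single 1
          (Finsupp.single 0
            (((p.1 : ℂ) + (q.1 : ℂ) + 2 * b) • X (p.1 + q.1) (p.2 + q.2)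
              + ((p.2 : ℂ) + (q.2 : ℂ)) • X (p.1 + q.1) (p.2 + q.2 - 1)))) := by
    rintro ⟨α, i⟩ ⟨β, j⟩
    rw [BA_apply, lie_X, nov_X, nov_X, add_comm β α, add_comm j i]
    congr 3
    module
  have hu : ∀ u : A3 Δ, u = Finsupp.sum (M := ℂ) (N := A3 Δ) u fun p k => k • X p.1 p.2 := by
    intro (u : (Δ × ℕ) →₀ ℂ)
    have h := (Finsupp.sum_single (M := ℂ) u).symm
    refine h.trans ?_
    refine Finset.sum_congr rfl fun p _ => ?_
    have : (Finsupp.single p (u p) : (Δ × ℕ) →₀ ℂ) = u p • x3 Δ p.1 p.2 := by simp [x3]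
    exact this
  conv_rhs => rw [hu u, hu v]
  simp only [Finsupp.sum, map_sum, LinearMap.sum_apply, map_smul, LinearMap.smul_apply, hX]
  unfold B3
  simp only [Finset.smul_sum, smul_smul]
  rw [Finset.sum_comm]
  refine Finset.sum_congr rfl fun p _ => ?_
  refine Finset.sum_congr rfl fun q _ => ?_
  first
    | (rw [mul_comm (v q) (u p)]; rfl)
    | exact congrArg (fun t : ℂ => t • _) (mul_comm _ _)

end Concrete
end QLCA
namespace QLCA
section Final
variable {Δ : AddSubgroup ℂ}

/-- coordinates -/
noncomputable def co (p : Δ × ℕ) : A3 Δ →ₗ[ℂ] ℂ := Finsupp.lapply (R := ℂ) (M := ℂ) p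

lemma co_X (β : Δ) (j : ℕ) (α : Δ) (i : ℕ) :
    co (α, i) (X β j) = if (β, j) = (α, i) then 1 else 0 := by
  classical
  exact Finsupp.single_apply

lemma co_ext {f g : A3 Δ} (h : ∀ p, co p f = co p g) : f = g := Finsupp.ext h

lemma co_finite (f : A3 Δ) : {p | co p f ≠ 0}.Finite := by
  refine Set.Finite.subset (Finset.finite_toSet (Finsupp.support (M := ℂ) f)) ?_
  intro p hp
  exact Finset.mem_coe.2 (Finsupp.mem_support_iff.2 hp)

lemma co_D (f : A3 Δ) (α : Δ) (i : ℕ) :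
    co (α, i) (D3 Δ f) = (α : ℂ) * co (α, i) f + ((i : ℂ) + 1) * co (α, i+1) f := by
  induction f using A3_ind with
  | h0 => simp
  | hadd f f' hf hf' => simp only [map_add, hf, hf']; ring
  | hs k β j =>
    simp only [Derivation.map_smul, map_smul, D3_X, map_add, co_X, smul_eq_mul, Prod.mk.injEq]
    by_cases hβ : β = α
    · subst hβ
      rcases j with _ | j
      · rcases i with _ | i
        · simp [mul_comm]
        · simp
      · by_cases h : j = i
        · subst h
          simp [mul_comm]
        · by_cases h' : j + 1 = i
          · subst h'
            simp [mul_comm]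
          · simp [h, h']
    · simp [hβ]

lemma S3_surj (b : ℂ) (x : A3 Δ) : ∃ y, SS (D3 Δ) b y = x := by
  suffices h : ∀ (α : Δ) (i : ℕ), ∃ y, SS (D3 Δ) b y = X α i by
    induction x using A3_ind with
    | h0 => exact ⟨0, map_zero _⟩
    | hadd f g hf hg =>
      obtain ⟨y, rfl⟩ := hf
      obtain ⟨z, rfl⟩ := hg
      exact ⟨y + z, map_add _ _ _⟩
    | hs k α i =>
      obtain ⟨y, hy⟩ := h α i
      exact ⟨k • y, by rw [map_smul, hy]⟩
  intro α i
  by_cases hk : (α : ℂ) + 2 * b = 0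
  · refine ⟨((i : ℂ) + 1)⁻¹ • X α (i+1), ?_⟩
    rw [map_smul, S3_X, hk, zero_smul, zero_add, smul_smul, Nat.cast_add_one,
      inv_mul_cancel₀ (Nat.cast_add_one_ne_zero i), one_smul, Nat.add_sub_cancel]
  · induction i with
    | zero =>
      refine ⟨((α : ℂ) + 2 * b)⁻¹ • X α 0, ?_⟩
      rw [map_smul, S3_X]
      simp [smul_smul, hk]
    | succ i ih =>
      obtain ⟨y, hy⟩ := ih
      refine ⟨((α : ℂ) + 2 * b)⁻¹ • (X α (i+1) - ((i : ℂ) + 1) • y), ?_⟩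
      rw [map_smul, map_sub, map_smul, hy, S3_X, Nat.add_sub_cancel, Nat.cast_add_one,
        add_sub_cancel_right, smul_smul, inv_mul_cancel₀ hk, one_smul]

lemma eig_form (g : A3 Δ) (hg : g ≠ 0) (μ : ℂ) (h : D3 Δ g = μ • g) :
    ∃ (α : Δ) (k : ℂ), k ≠ 0 ∧ g = k • X α 0 := by
  have hc : ∀ (α : Δ) (i : ℕ), ((i : ℂ) + 1) * co (α, i+1) g = (μ - α) * co (α, i) g := by
    intro α i
    have := congrArg (co (α, i)) h
    rw [co_D, map_smul, smul_eq_mul] at this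
    linear_combination this
  have h1 : ∀ (α : Δ) (i : ℕ), co (α, i) g ≠ 0 → (α : ℂ) = μ := by
    intro α i hi
    by_contra hne
    have hall : ∀ n, co (α, i + n) g ≠ 0 := by
      intro n
      induction n with
      | zero => exact hi
      | succ n ih =>
        intro h0
        have := hc α (i + n)
        rw [add_assoc, h0, mul_zero] at this
        rcases mul_eq_zero.1 this.symm with h2 | h2
        · exact hne (sub_eq_zero.1 h2).symm
        · exact ih h2
    have hinf : (Set.range fun n : ℕ => (α, i + n)).Infinite :=
      Set.infinite_range_of_injective (fun m n hmn => by simpa using hmn)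
    exact hinf ((co_finite g).subset (by rintro _ ⟨n, rfl⟩; exact hall n))
  obtain ⟨⟨α, i⟩, hp⟩ : ∃ p, co p g ≠ 0 := by
    by_contra hcon
    push Not at hcon
    exact hg (co_ext (fun p => by rw [hcon p, map_zero]))
  have hα := h1 α i hp
  have hz : ∀ n, co (α, n+1) g = 0 := by
    intro n
    have := hc α n
    rw [hα, sub_self, zero_mul] at this
    rcases mul_eq_zero.1 this with h2 | h2
    · exact absurd h2 (Nat.cast_add_one_ne_zero n)
    · exact h2
  have hform : g = co (α, 0) g • X α 0 := by
    refine co_ext ?_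
    rintro ⟨β, j⟩
    rw [map_smul, co_X, smul_eq_mul]
    by_cases hβ : β = α
    · subst hβ
      rcases j with _ | j
      · simp
      · simp [hz j]
    · rw [if_neg (by simp; intro h; exact absurd h.symm hβ), mul_zero]
      by_contra hne
      exact hβ (Subtype.ext ((h1 β j hne).trans hα.symm))
  refine ⟨α, _, ?_, hform⟩
  intro h0
  rw [h0, zero_smul] at hform
  exact hg hform

lemma D3_ideal (J : Ideal (A3 Δ)) (hJ : ∀ x ∈ J, D3 Δ x ∈ J) (hne : J ≠ ⊥) : J = ⊤ := by
  obtain ⟨f, hfJ, hf0⟩ := (Submodule.ne_bot_iff J).1 hne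
  -- a finite downward closed set containing the support of `f`
  obtain ⟨F, hFfin, hfF, hFdown⟩ : ∃ F : Set (Δ × ℕ), F.Finite ∧ (∀ p, co p f ≠ 0 → p ∈ F) ∧
      ∀ (α : Δ) (i : ℕ), (α, i+1) ∈ F → (α, i) ∈ F := by
    have hfin := co_finite f
    obtain ⟨M, hM⟩ := (hfin.image Prod.snd).bddAbove
    refine ⟨(Set.image Prod.fst {p | co p f ≠ 0}) ×ˢ Set.Iic M,
      (hfin.image _).prod (Set.finite_Iic M), ?_, ?_⟩
    · intro p hp
      exact ⟨⟨p, hp, rfl⟩, hM ⟨p, hp, rfl⟩⟩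
    · rintro α i ⟨h1, h2⟩
      exact ⟨h1, le_trans (Nat.le_succ i) h2⟩
  let U : Submodule ℂ (A3 Δ) := Finsupp.supported ℂ ℂ F
  have memU : ∀ g : A3 Δ, g ∈ U ↔ ∀ p, p ∉ F → co p g = 0 := fun g =>
    Finsupp.mem_supported' ℂ g
  haveI : Finite F := hFfin
  haveI : FiniteDimensional ℂ U :=
    Module.Finite.equiv (Finsupp.supportedEquivFinsupp (M := ℂ) (R := ℂ) F).symm
  let K : Submodule ℂ (A3 Δ) := J.restrictScalars ℂ ⊓ U
  haveI : FiniteDimensional ℂ K := Submodule.finiteDimensional_of_le inf_le_right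
  have hK : ∀ x ∈ K, (D3 Δ : A3 Δ →ₗ[ℂ] A3 Δ) x ∈ K := by
    rintro x ⟨hx1, hx2⟩
    refine ⟨hJ x hx1, ?_⟩
    have hx3 := (memU x).1 hx2
    refine (memU _).2 ?_
    rintro ⟨α, i⟩ hp
    have := co_D x α i
    rw [hx3 _ hp, hx3 _ (fun h => hp (hFdown α i h)), mul_zero, mul_zero, add_zero] at this
    exact this
  have hfK : f ∈ K := ⟨hfJ, (memU f).2 fun p hp => by
    by_contra h; exact hp (hfF p h)⟩
  haveI : Nontrivial K := ⟨⟨⟨f, hfK⟩, 0, fun h => hf0 (congrArg Subtype.val h)⟩⟩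
  obtain ⟨μ, hμ⟩ := Module.End.exists_eigenvalue ((D3 Δ : A3 Δ →ₗ[ℂ] A3 Δ).restrict hK)
  obtain ⟨g, hg⟩ := hμ.exists_hasEigenvector
  have hg1 := congrArg Subtype.val hg.apply_eq_smul
  obtain ⟨α, k, hk, hgk⟩ := eig_form g.1 (fun h => hg.2 (Subtype.ext h)) μ hg1
  have hgJ : g.1 ∈ J := g.2.1
  rw [Ideal.eq_top_iff_one]
  have := J.mul_mem_left (k⁻¹ • X (-α) 0) hgJ
  rw [hgk, smul_mul_assoc, mul_smul_comm, X_mul, smul_smul, inv_mul_cancel₀ hk, one_smul,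
    neg_add_cancel] at this
  exact this

lemma A3_main (b : ℂ) (φ : Δ →+ ℂ) (c : ℂ) :
    IsLieConf (V := A3 Δ) (B3 Δ b φ c) ∧ ConfSimple (V := A3 Δ) (B3 Δ b φ c) := by
  rw [B3_eq]
  haveI : Nontrivial (A3 Δ) := inferInstanceAs (Nontrivial ((Δ × ℕ) →₀ ℂ))
  refine ⟨BA_isLieConf _ _ _ (der_comm _ _ _ _), BA_simple _ _ _ (S3_surj b) (X 0 1) ?_ D3_ideal⟩
  rw [D3_X]
  simp [X_one]

end Final
end QLCA

/-- for `b ≠ 0`, an additive group homomorphism `φ : Δ → ℂ` and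
`c ∈ ℂ`, `CL₃(b,φ,c)` is a simple Lie conformal algebra. -/
theorem stmt_18 (Δ : AddSubgroup ℂ) (b : ℂ) (hb : b ≠ 0) (φ : Δ →+ ℂ)
    (c : ℂ) : IsLieConf (B3 Δ b φ c) ∧ ConfSimple (B3 Δ b φ c) := by
  exact A3_main b φ c
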